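/- No-punish property of VTC: let U = max(w_p·L_input, w_q·M). If client f is continuously backlogged during the interval (t1, t2), then for every other client g, the services received under the VTC algorithm satisfy W_f(t1,t2) ≥ W_g(t1,t2) − 4U. -/

import Mathlib

/-!
A formal model of the Virtual Token Counter (VTC) scheduler.

There is a finite set of clients and fixed positive constants: `wp` and `wq`,
the per-token costs of input and output tokens; `Linput`, the maximum number of
input tokens of any single request; `M`, the maximum number of tokens the
server can hold in memory at once.  The scheduler maintains a real-valued
virtual counter `c i` for each client `i` and a set `Q` of backlogged clients.
The state additionally records `lastMin`, the value of `min_{i∈Q} c i` at the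
last instant `Q` was nonempty; `schedC i`, the counter value of client `i` at
the time its most recently scheduled request was scheduled (a time at which
`c i = min_{j∈Q} c j` held); and `w i`, the cumulative service received by
client `i` (`wp` per processed input token plus `wq` per generated output
token).
-/

/-- Fixed positive parameters of the VTC model. -/
structure VTCParams where
  wp : ℝ
  wq : ℝ
  Linput : ℝ
  M : ℝ
  wp_pos : 0 < wp
  wq_pos : 0 < wq
  Linput_pos : 0 < Linput
  M_pos : 0 < M

/-- The scheduler state. -/
structure VTCState (C : Type*) where
  /-- virtual counters -/
  c : C → ℝ
  /-- set of backlogged clients -/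
  Q : Finset C
  /-- the value of `min_{i∈Q} c i` at the last instant `Q` was nonempty -/
  lastMin : ℝ
  /-- counter value of each client at the time of its most recent prefill scheduling -/
  schedC : C → ℝ
  /-- cumulative service received by each client -/
  w : C → ℝ

namespace VTCState

variable {C : Type*}

/-- The minimum counter over backlogged clients (its last nonempty value if `Q = ∅`). -/
noncomputable def minQ (s : VTCState C) : ℝ :=
  if h : s.Q.Nonempty then s.Q.inf' h s.c else s.lastMin

/-- Build the successor state from new counters, backlog set, schedule record and
service record, maintaining the `lastMin` field. -/
noncomputable def next (s : VTCState C) (c' : C → ℝ) (Q' : Finset C) (sc' w' : C → ℝ) :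
    VTCState C :=
  { c := c', Q := Q', schedC := sc', w := w',
    lastMin := if h : Q'.Nonempty then Q'.inf' h c' else s.minQ }

end VTCState

/-- The transitions of the VTC scheduler.

(Arrival) a client `u` not in `Q` becomes backlogged: `Q` becomes `Q ∪ {u}` and
`c u` is replaced by `max (c u) (min_{i∈Q} c i)` (using the last nonempty value
of the minimum if `Q` was empty).

(Departure) a client with no waiting or running requests leaves `Q`; counters
are unchanged.

(Prefill) a waiting request of input length `0 < l ≤ Linput` of a client `k`
attaining the minimum counter among backlogged clients is scheduled and `c k`
increases by `wp * l` (which is also service delivered to `k`); the counter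
value of `k` at scheduling time is recorded.

(Decode) the counter of a client `k` with running requests increases by `wq`
per newly generated output token (here one token per step, which is also
service delivered to `k`); since at most `M` tokens fit in memory, the total
decode charge to `k` since the time its most recently scheduled request was
scheduled is at most `wq * M`. -/
inductive VTCStep {C : Type*} [DecidableEq C] (p : VTCParams) :
    VTCState C → VTCState C → Prop
  | arrival (s : VTCState C) (u : C) (hu : u ∉ s.Q) :
      VTCStep p s (s.next (Function.update s.c u (max (s.c u) s.minQ))
        (insert u s.Q) s.schedC s.w)
  | departure (s : VTCState C) (u : C) (hu : u ∈ s.Q) :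
      VTCStep p s (s.next s.c (s.Q.erase u) s.schedC s.w)
  | prefill (s : VTCState C) (k : C) (l : ℝ) (hk : k ∈ s.Q)
      (hmin : ∀ i ∈ s.Q, s.c k ≤ s.c i) (hl0 : 0 < l) (hlL : l ≤ p.Linput) :
      VTCStep p s (s.next (Function.update s.c k (s.c k + p.wp * l)) s.Q
        (Function.update s.schedC k (s.c k))
        (Function.update s.w k (s.w k + p.wp * l)))
  | decode (s : VTCState C) (k : C) (hk : k ∈ s.Q)
      (hmem : s.c k + p.wq ≤ s.schedC k + p.wq * p.M) :
      VTCStep p s (s.next (Function.update s.c k (s.c k + p.wq)) s.Q s.schedC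
        (Function.update s.w k (s.w k + p.wq)))

/-- The initial state: all counters zero, no backlogged clients. -/
def VTCInit (C : Type*) : VTCState C :=
  { c := fun _ => 0, Q := ∅, lastMin := 0, schedC := fun _ => 0, w := fun _ => 0 }

/-- A state is reachable if it can be obtained from the initial state by a
finite sequence of VTC transitions. -/
def VTCReachable {C : Type*} [DecidableEq C] (p : VTCParams) (s : VTCState C) : Prop :=
  Relation.ReflTransGen (VTCStep p) (VTCInit C) s

/-- An execution trace of the VTC scheduler, indexed by discrete time
(stuttering allowed). -/
def VTCTraj {C : Type*} [DecidableEq C] (p : VTCParams) (traj : ℕ → VTCState C) : Prop :=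
  traj 0 = VTCInit C ∧ ∀ n, VTCStep p (traj n) (traj (n + 1)) ∨ traj (n + 1) = traj n

namespace VTCState

variable {C : Type*}

lemma minQ_le (s : VTCState C) {i : C} (hi : i ∈ s.Q) : s.minQ ≤ s.c i := by
  rw [minQ, dif_pos ⟨i, hi⟩]
  exact Finset.inf'_le _ hi

lemma minQ_le_minQ_next (s : VTCState C) {c' : C → ℝ} {Q' : Finset C} (sc' w' : C → ℝ)
    (h : ∀ i ∈ Q', s.minQ ≤ c' i) : s.minQ ≤ (s.next c' Q' sc' w').minQ := by
  by_cases hQ : Q'.Nonempty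
  · simp only [minQ, next, dif_pos hQ]
    exact Finset.le_inf' hQ c' h
  · simp [minQ, next, hQ]

/-- The bounds relating counters, scheduling records and the minimum backlogged counter that
hold in every state of a VTC execution. -/
structure Bounded (p : VTCParams) (s : VTCState C) : Prop where
  c_le (k : C) : s.c k ≤ s.minQ + max (p.wp * p.Linput) (p.wq * p.M)
  schedC_le_minQ (k : C) : s.schedC k ≤ s.minQ
  schedC_le_c (k : C) : s.schedC k ≤ s.c k

end VTCState

namespace VTCStep

variable {C : Type*} [DecidableEq C] {p : VTCParams} {s s' : VTCState C}

lemma minQ_mono (h : VTCStep p s s') : s.minQ ≤ s'.minQ := by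
  cases h with
  | arrival u hu =>
    refine s.minQ_le_minQ_next _ _ fun i hi => ?_
    rcases eq_or_ne i u with rfl | hne
    · simp
    · simpa [hne] using s.minQ_le (Finset.mem_of_mem_insert_of_ne hi hne)
  | departure u hu =>
    exact s.minQ_le_minQ_next _ _ fun i hi => s.minQ_le (Finset.mem_of_mem_erase hi)
  | prefill k l hk hmin hl0 hlL =>
    refine s.minQ_le_minQ_next _ _ fun i hi => ?_
    have hi' := s.minQ_le hi
    have := mul_pos p.wp_pos hl0
    rcases eq_or_ne i k with rfl | hne
    · simp only [Function.update_self]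
      linarith
    · simpa [hne] using hi'
  | decode k hk hmem =>
    refine s.minQ_le_minQ_next _ _ fun i hi => ?_
    have hi' := s.minQ_le hi
    have := p.wq_pos
    rcases eq_or_ne i k with rfl | hne
    · simp only [Function.update_self]
      linarith
    · simpa [hne] using hi'

lemma bounded (h : VTCStep p s s') (hs : s.Bounded p) : s'.Bounded p := by
  have hmono := h.minQ_mono
  have hU : 0 ≤ max (p.wp * p.Linput) (p.wq * p.M) :=
    le_max_of_le_left (mul_pos p.wp_pos p.Linput_pos).le
  have hc := fun i => (hs.c_le i).trans (add_le_add_left hmono _)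
  have hsm := fun i => (hs.schedC_le_minQ i).trans hmono
  cases h with
  | arrival u hu =>
    refine ⟨fun i => ?_, hsm, fun i => ?_⟩
    · rcases eq_or_ne i u with rfl | hne
      · refine le_of_eq_of_le (Function.update_self ..) (max_le (hc i) ?_)
        linarith
      · exact le_of_eq_of_le (Function.update_of_ne hne ..) (hc i)
    · rcases eq_or_ne i u with rfl | hne
      · simpa [VTCState.next] using Or.inl (hs.schedC_le_c i)
      · simpa [VTCState.next, hne] using hs.schedC_le_c i
  | departure u hu => exact ⟨hc, hsm, hs.schedC_le_c⟩
  | prefill k l hk hmin hl0 hlL =>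
    have hck : s.c k ≤ s.minQ := by
      rw [VTCState.minQ, dif_pos ⟨k, hk⟩]
      exact Finset.le_inf' _ _ hmin
    have hl := mul_pos p.wp_pos hl0
    have hlU := (mul_le_mul_of_nonneg_left hlL p.wp_pos.le).trans
      (le_max_left (p.wp * p.Linput) (p.wq * p.M))
    refine ⟨fun i => ?_, fun i => ?_, fun i => ?_⟩
    · rcases eq_or_ne i k with rfl | hne
      · refine le_of_eq_of_le (Function.update_self ..) ?_
        linarith
      · exact le_of_eq_of_le (Function.update_of_ne hne ..) (hc i)
    · rcases eq_or_ne i k with rfl | hne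
      · exact le_of_eq_of_le (Function.update_self ..) (hck.trans hmono)
      · exact le_of_eq_of_le (Function.update_of_ne hne ..) (hsm i)
    · rcases eq_or_ne i k with rfl | hne
      · simpa [VTCState.next] using hl.le
      · simpa [VTCState.next, hne] using hs.schedC_le_c i
  | decode k hk hmem =>
    have hwq := p.wq_pos
    have hMU := le_max_right (p.wp * p.Linput) (p.wq * p.M)
    refine ⟨fun i => ?_, hsm, fun i => ?_⟩
    · rcases eq_or_ne i k with rfl | hne
      · refine le_of_eq_of_le (Function.update_self ..) ?_
        linarith [hsm i]
      · exact le_of_eq_of_le (Function.update_of_ne hne ..) (hc i)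
    · have := hs.schedC_le_c i
      rcases eq_or_ne i k with rfl | hne
      · simp only [VTCState.next, Function.update_self]
        linarith
      · simpa [VTCState.next, hne] using this

lemma c_mono (h : VTCStep p s s') (i : C) : s.c i ≤ s'.c i := by
  cases h with
  | arrival u hu => rcases eq_or_ne i u with rfl | hne <;> simp [VTCState.next, *]
  | departure u hu => exact le_rfl
  | prefill k l hk hmin hl0 hlL =>
    have := mul_pos p.wp_pos hl0
    rcases eq_or_ne i k with rfl | hne
    · simpa [VTCState.next] using this.le
    · simp [VTCState.next, hne]
  | decode k hk hmem =>
    rcases eq_or_ne i k with rfl | hne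
    · simpa [VTCState.next] using p.wq_pos.le
    · simp [VTCState.next, hne]

lemma w_mono (h : VTCStep p s s') (i : C) : s.w i ≤ s'.w i := by
  cases h with
  | arrival u hu => exact le_rfl
  | departure u hu => exact le_rfl
  | prefill k l hk hmin hl0 hlL =>
    have := mul_pos p.wp_pos hl0
    rcases eq_or_ne i k with rfl | hne
    · simpa [VTCState.next] using this.le
    · simp [VTCState.next, hne]
  | decode k hk hmem =>
    rcases eq_or_ne i k with rfl | hne
    · simpa [VTCState.next] using p.wq_pos.le
    · simp [VTCState.next, hne]

lemma w_le_add (h : VTCStep p s s') (hs : s.Bounded p) (i : C) :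
    s'.w i ≤ s.w i + max (p.wp * p.Linput) (p.wq * p.M) := by
  have hU : 0 ≤ max (p.wp * p.Linput) (p.wq * p.M) :=
    le_max_of_le_left (mul_pos p.wp_pos p.Linput_pos).le
  cases h with
  | arrival u hu => exact le_add_of_nonneg_right hU
  | departure u hu => exact le_add_of_nonneg_right hU
  | prefill k l hk hmin hl0 hlL =>
    rcases eq_or_ne i k with rfl | hne
    · refine le_of_eq_of_le (Function.update_self ..) (add_le_add_right ?_ _)
      exact (mul_le_mul_of_nonneg_left hlL p.wp_pos.le).trans (le_max_left _ _)
    · exact le_of_eq_of_le (Function.update_of_ne hne ..) (le_add_of_nonneg_right hU)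
  | decode k hk hmem =>
    rcases eq_or_ne i k with rfl | hne
    · refine le_of_eq_of_le (Function.update_self ..) (add_le_add_right ?_ _)
      refine le_trans ?_ (le_max_right _ _)
      linarith [hs.schedC_le_c i]
    · exact le_of_eq_of_le (Function.update_of_ne hne ..) (le_add_of_nonneg_right hU)

lemma w_eq_of_notMem (h : VTCStep p s s') {i : C} (hi : i ∉ s.Q) : s'.w i = s.w i := by
  cases h with
  | arrival u hu => rfl
  | departure u hu => rfl
  | prefill k l hk hmin hl0 hlL =>
    exact Function.update_of_ne (ne_of_mem_of_not_mem hk hi).symm ..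
  | decode k hk hmem =>
    exact Function.update_of_ne (ne_of_mem_of_not_mem hk hi).symm ..

lemma w_sub_eq_of_mem (h : VTCStep p s s') {i : C} (hi : i ∈ s.Q) :
    s'.w i - s.w i = s'.c i - s.c i := by
  cases h with
  | arrival u hu =>
    have hne : i ≠ u := fun h => hu (h ▸ hi)
    simp [VTCState.next, hne]
  | departure u hu => simp [VTCState.next]
  | prefill k l hk hmin hl0 hlL =>
    rcases eq_or_ne i k with rfl | hne <;> simp [VTCState.next, *]
  | decode k hk hmem =>
    rcases eq_or_ne i k with rfl | hne <;> simp [VTCState.next, *]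

end VTCStep

namespace VTCTraj

variable {C : Type*} [DecidableEq C] {p : VTCParams} {traj : ℕ → VTCState C}

lemma bounded (h : VTCTraj p traj) (n : ℕ) : (traj n).Bounded p := by
  induction n with
  | zero =>
    have hU : 0 ≤ max (p.wp * p.Linput) (p.wq * p.M) :=
      le_max_of_le_left (mul_pos p.wp_pos p.Linput_pos).le
    rw [h.1]
    have hmin : (VTCInit C).minQ = 0 := dif_neg Finset.not_nonempty_empty
    refine ⟨fun k => ?_, fun k => hmin.ge, fun k => le_rfl⟩
    rw [hmin, zero_add]
    exact hU
  | succ n ih =>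
    rcases h.2 n with hs | hs
    · exact hs.bounded ih
    · rwa [hs]

lemma minQ_mono (h : VTCTraj p traj) : Monotone fun n => (traj n).minQ := by
  refine monotone_nat_of_le_succ fun n => ?_
  rcases h.2 n with hs | hs
  · exact hs.minQ_mono
  · rw [hs]

lemma w_mono (h : VTCTraj p traj) (i : C) : Monotone fun n => (traj n).w i := by
  refine monotone_nat_of_le_succ fun n => ?_
  rcases h.2 n with hs | hs
  · exact hs.w_mono i
  · rw [hs]

lemma w_succ_le (h : VTCTraj p traj) (n : ℕ) (i : C) :
    (traj (n + 1)).w i ≤ (traj n).w i + max (p.wp * p.Linput) (p.wq * p.M) := by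
  rcases h.2 n with hs | hs
  · exact hs.w_le_add (h.bounded n) i
  · rw [hs]
    exact le_add_of_nonneg_right (le_max_of_le_left (mul_pos p.wp_pos p.Linput_pos).le)

lemma w_sub_le_max (h : VTCTraj p traj) (i : C) {a b : ℕ} (hab : a ≤ b) :
    (traj b).w i - (traj a).w i ≤ max 0 ((traj b).c i - (traj a).minQ) := by
  induction b, hab using Nat.le_induction with
  | base => simp
  | succ b hab ih =>
    rcases h.2 b with hs | hs
    · by_cases hi : i ∈ (traj b).Q
      · have hmin := (h.minQ_mono hab).trans ((traj b).minQ_le hi)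
        rw [max_eq_right (sub_nonneg.2 hmin)] at ih
        refine le_max_of_le_right ?_
        linarith [hs.w_sub_eq_of_mem hi]
      · rw [hs.w_eq_of_notMem hi]
        exact ih.trans (max_le_max_left _ (sub_le_sub_right (hs.c_mono i) _))
    · rwa [hs]

/-- The service received by any client is at most the growth of the minimum backlogged counter
plus `max (wp * Linput) (wq * M)`. -/
lemma w_sub_le (h : VTCTraj p traj) (i : C) {a b : ℕ} (hab : a ≤ b) :
    (traj b).w i - (traj a).w i ≤
      (traj b).minQ - (traj a).minQ + max (p.wp * p.Linput) (p.wq * p.M) := by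
  have hU : 0 ≤ max (p.wp * p.Linput) (p.wq * p.M) :=
    le_max_of_le_left (mul_pos p.wp_pos p.Linput_pos).le
  have hmin : (traj a).minQ ≤ (traj b).minQ := h.minQ_mono hab
  refine (h.w_sub_le_max i hab).trans (max_le ?_ ?_)
  · linarith
  · linarith [(h.bounded b).c_le i]

lemma w_sub_eq_of_mem (h : VTCTraj p traj) {i : C} {a b : ℕ} (hab : a ≤ b)
    (hi : ∀ m, a ≤ m → m < b → i ∈ (traj m).Q) :
    (traj b).w i - (traj a).w i = (traj b).c i - (traj a).c i := by
  induction b, hab using Nat.le_induction with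
  | base => simp
  | succ b hab ih =>
    have ih := ih fun m ham hmb => hi m ham (hmb.trans b.lt_succ_self)
    rcases h.2 b with hs | hs
    · linarith [hs.w_sub_eq_of_mem (hi b hab b.lt_succ_self)]
    · rwa [hs]

/-- A client that is backlogged throughout receives at least the growth of the minimum backlogged
counter minus `max (wp * Linput) (wq * M)`. -/
lemma le_w_sub (h : VTCTraj p traj) {i : C} {a b : ℕ} (hab : a ≤ b)
    (hi : ∀ m, a ≤ m → m ≤ b → i ∈ (traj m).Q) :
    (traj b).minQ - (traj a).minQ - max (p.wp * p.Linput) (p.wq * p.M) ≤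
      (traj b).w i - (traj a).w i := by
  rw [h.w_sub_eq_of_mem hab fun m ham hmb => hi m ham hmb.le]
  linarith [(h.bounded a).c_le i, (traj b).minQ_le (hi b hab le_rfl)]

end VTCTraj

/-- **no-punish property of VTC.** Let
`U = max (wp·Linput) (wq·M)`.  If client `f` is continuously backlogged during
the interval `(t1, t2)`, then for every other client `g` the services received
under the VTC algorithm satisfy `W_f(t1,t2) ≥ W_g(t1,t2) − 4U`, where the
service `W_i(t1,t2)` received by client `i` during the interval (`wp` times the
number of `i`'s input tokens processed plus `wq` times the number of `i`'s
output tokens generated) is `w i` at `t2` minus `w i` at `t1`. -/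
theorem vtc_no_punish {C : Type*} [DecidableEq C] (p : VTCParams)
    (traj : ℕ → VTCState C) (htraj : VTCTraj p traj)
    (t1 t2 : ℕ) (h12 : t1 ≤ t2) (f : C)
    (hf : ∀ m, t1 < m → m < t2 → f ∈ (traj m).Q) (g : C) :
    (traj t2).w f - (traj t1).w f ≥
      ((traj t2).w g - (traj t1).w g) - 4 * max (p.wp * p.Linput) (p.wq * p.M) := by
  have hU : 0 ≤ max (p.wp * p.Linput) (p.wq * p.M) :=
    le_max_of_le_left (mul_pos p.wp_pos p.Linput_pos).le
  have hwf : (traj t1).w f ≤ (traj t2).w f := htraj.w_mono f h12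
  obtain rfl | rfl | h : t1 = t2 ∨ t2 = t1 + 1 ∨ t1 + 2 ≤ t2 := by omega
  · linarith
  · linarith [htraj.w_succ_le t1 g]
  · obtain ⟨b, rfl⟩ : ∃ b, t2 = b + 1 := ⟨t2 - 1, by omega⟩
    have hab : t1 + 1 ≤ b := by omega
    have hf1 : (traj t1).w f ≤ (traj (t1 + 1)).w f := htraj.w_mono f t1.le_succ
    have hf2 : (traj b).w f ≤ (traj (b + 1)).w f := htraj.w_mono f b.le_succ
    linarith [htraj.w_succ_le t1 g, htraj.w_succ_le b g, htraj.w_sub_le g hab,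
      htraj.le_w_sub hab fun m ham hmb => hf m (by omega) (by omega)]
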